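/- Let g ≥ 3, let p be an odd prime, and let s ≥ 1. Let M = Hom(sp_{2g}(ℤ/pℤ), ℤ/pℤ) be the ℤ/pℤ-linear dual of sp_{2g}(ℤ/pℤ), on which G = Sp_{2g}(ℤ/p^sℤ) acts by (u·φ)(X) = φ(ū⁻¹·X·ū), where ū ∈ Sp_{2g}(ℤ/pℤ) is the reduction of u modulo p. Then the first group cohomology H¹(G, M) vanishes. -/

import Mathlib

open Matrix

/-- The paper's standard symplectic form matrix `J = [[0, 1_g], [-1_g, 0]]`. -/
def paperJ (l R : Type*) [DecidableEq l] [CommRing R] : Matrix (l ⊕ l) (l ⊕ l) R :=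
  Matrix.fromBlocks 0 1 (-1) 0

/-- The paper's symplectic condition `ᵀM·J·M = J` (with `J = [[0, 1_g], [-1_g, 0]]`)
characterizes membership in Mathlib's `Matrix.symplecticGroup`; hence the latter *is* the
symplectic group `Sp_{2g}(R)` of the paper. -/
theorem mem_symplecticGroup_iff_paper {l R : Type*} [DecidableEq l] [Fintype l] [CommRing R]
    (M : Matrix (l ⊕ l) (l ⊕ l) R) :
    M ∈ Matrix.symplecticGroup l R ↔ Mᵀ * paperJ l R * M = paperJ l R := by
  have hJ : paperJ l R = -(Matrix.J l R) := by
    rw [paperJ, Matrix.J, Matrix.fromBlocks_neg]; norm_num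
  rw [SymplecticGroup.mem_iff', hJ]
  constructor
  · intro h; rw [Matrix.mul_neg, Matrix.neg_mul, h]
  · intro h
    have := congrArg Neg.neg h
    simpa [Matrix.mul_neg, Matrix.neg_mul] using this

/-- The Lie algebra `sp_{2g}(R)`: the `R`-module of matrices `X` with `ᵀX·J + J·X = 0`. -/
def spLie (l R : Type*) [DecidableEq l] [Fintype l] [CommRing R] :
    Submodule R (Matrix (l ⊕ l) (l ⊕ l) R) where
  carrier := {X | Xᵀ * paperJ l R + paperJ l R * X = 0}
  add_mem' := by
    intro a b ha hb
    simp only [Set.mem_setOf_eq] at *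
    rw [Matrix.transpose_add, Matrix.add_mul, Matrix.mul_add]
    calc aᵀ * paperJ l R + bᵀ * paperJ l R + (paperJ l R * a + paperJ l R * b)
        = (aᵀ * paperJ l R + paperJ l R * a) + (bᵀ * paperJ l R + paperJ l R * b) := by abel
      _ = 0 := by rw [ha, hb, add_zero]
  zero_mem' := by simp
  smul_mem' := by
    intro c x hx
    simp only [Set.mem_setOf_eq] at *
    rw [Matrix.transpose_smul, Matrix.smul_mul, Matrix.mul_smul, ← smul_add, hx, smul_zero]

/-- Entrywise reduction modulo `p` of a matrix over `ℤ/p^sℤ`. -/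
def matRed (g p s : ℕ) (hs : 1 ≤ s)
    (u : Matrix (Fin g ⊕ Fin g) (Fin g ⊕ Fin g) (ZMod (p ^ s))) :
    Matrix (Fin g ⊕ Fin g) (Fin g ⊕ Fin g) (ZMod p) :=
  u.map (ZMod.castHom (dvd_pow_self p (Nat.one_le_iff_ne_zero.mp hs)) (ZMod p))

namespace SpCohomology

theorem paperJ_transpose {l R : Type*} [DecidableEq l] [CommRing R] :
    (paperJ l R)ᵀ = -paperJ l R := by
  simp [paperJ, Matrix.fromBlocks_transpose, Matrix.fromBlocks_neg]

section Transvection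

variable {l R : Type*} [DecidableEq l] [Fintype l] [CommRing R]

/-- The symplectic pairing `⟨v, w⟩ = ᵀv·J·w`. -/
def om (v w : l ⊕ l → R) : R := v ⬝ᵥ (paperJ l R *ᵥ w)

theorem om_eq_sum (v w : l ⊕ l → R) :
    om v w = ∑ i, v (Sum.inl i) * w (Sum.inr i) - ∑ i, v (Sum.inr i) * w (Sum.inl i) := by
  simp [om, paperJ, Matrix.fromBlocks_mulVec, dotProduct, Fintype.sum_sum_type, sub_eq_add_neg,
    neg_mulVec]

theorem om_add_left (v v' w : l ⊕ l → R) : om (v + v') w = om v w + om v' w := by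
  simp [om, add_dotProduct]

theorem om_add_right (v w w' : l ⊕ l → R) : om v (w + w') = om v w + om v w' := by
  simp [om, mulVec_add, dotProduct_add]

theorem om_sub_right (v w w' : l ⊕ l → R) : om v (w - w') = om v w - om v w' := by
  simp [om, mulVec_sub, dotProduct_sub]

theorem om_smul_left (r : R) (v w : l ⊕ l → R) : om (r • v) w = r * om v w := by
  simp [om]

theorem om_smul_right (r : R) (v w : l ⊕ l → R) : om v (r • w) = r * om v w := by
  simp [om, mulVec_smul]

theorem om_neg_left (v w : l ⊕ l → R) : om (-v) w = -om v w := by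
  simp [om]

theorem om_neg_right (v w : l ⊕ l → R) : om v (-w) = -om v w := by
  simp [om, mulVec_neg]

theorem om_swap (v w : l ⊕ l → R) : om w v = -om v w := by
  simp [om_eq_sum, mul_comm]

theorem om_self (v : l ⊕ l → R) : om v v = 0 := by
  simp [om_eq_sum, mul_comm]

theorem om_mulVec (u : symplecticGroup l R) (v w : l ⊕ l → R) :
    om (u.1 *ᵥ v) (u.1 *ᵥ w) = om v w := by
  have h := (mem_symplecticGroup_iff_paper u.1).1 u.2
  rw [om, om, mulVec_mulVec, ← vecMul_transpose, ← dotProduct_mulVec, mulVec_mulVec,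
    ← Matrix.mul_assoc, h]

/-- The symplectic transvection `w ↦ w + ⟨v, w⟩ v`. -/
def transv (v : l ⊕ l → R) : symplecticGroup l R :=
  ⟨1 + vecMulVec v (v ᵥ* paperJ l R), by
    have h0 : (v ᵥ* paperJ l R) ⬝ᵥ v = 0 := by
      rw [← dotProduct_mulVec]; exact om_self v
    have h1 : paperJ l R *ᵥ v = -(v ᵥ* paperJ l R) := by
      rw [← mulVec_transpose, paperJ_transpose, neg_mulVec, neg_neg]
    rw [mem_symplecticGroup_iff_paper]
    simp only [transpose_add, transpose_one, transpose_vecMulVec, Matrix.add_mul, Matrix.mul_add,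
      Matrix.one_mul, Matrix.mul_one, vecMulVec_mul, mul_vecMulVec]
    rw [add_mulVec, vecMulVec_mulVec, h0, h1]
    simp [neg_vecMulVec]⟩

theorem transv_mulVec (v w : l ⊕ l → R) : (transv v).1 *ᵥ w = w + om v w • v := by
  simp only [transv, add_mulVec, one_mulVec, om, dotProduct_mulVec, vecMulVec_mulVec]
  rw [op_smul_eq_smul]

theorem ext_mulVec {u u' : symplecticGroup l R} (h : ∀ v, u.1 *ᵥ v = u'.1 *ᵥ v) : u = u' :=
  Subtype.ext (Matrix.toLin'.injective (LinearMap.ext h))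

theorem mulVec_mul_apply (u u' : symplecticGroup l R) (v : l ⊕ l → R) :
    (u * u').1 *ᵥ v = u.1 *ᵥ (u'.1 *ᵥ v) := by
  simp [mulVec_mulVec]

theorem inv_mulVec_eq {u : symplecticGroup l R} {v w : l ⊕ l → R} (h : u.1 *ᵥ w = v) :
    (u⁻¹).1 *ᵥ v = w := by
  rw [← h, ← mulVec_mul_apply]; simp

theorem mul_transv (u : symplecticGroup l R) (v : l ⊕ l → R) :
    u * transv v = transv (u.1 *ᵥ v) * u := by
  refine ext_mulVec fun w => ?_
  rw [mulVec_mul_apply, mulVec_mul_apply, transv_mulVec, transv_mulVec, om_mulVec, mulVec_add,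
    mulVec_smul]

theorem transv_pow_mulVec (v w : l ⊕ l → R) (n : ℕ) :
    (transv v ^ n).1 *ᵥ w = w + ((n : R) * om v w) • v := by
  induction n with
  | zero => simp
  | succ n ih =>
    rw [pow_succ', mulVec_mul_apply, ih, transv_mulVec, om_add_right, om_smul_right, om_self]
    push_cast
    module

theorem transv_neg (v : l ⊕ l → R) : transv (-v) = transv v := by
  refine ext_mulVec fun w => ?_
  simp [transv_mulVec, om_neg_left]

theorem transv_commute {v w : l ⊕ l → R} (h : om v w = 0) : Commute (transv v) (transv w) := by
  have := mul_transv (transv v) w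
  rw [transv_mulVec, h, zero_smul, add_zero] at this
  exact this

/-- The basis vector `e i` of the standard symplectic basis. -/
def ve (i : l) : l ⊕ l → R := Pi.single (Sum.inl i) 1

/-- The basis vector `f i` of the standard symplectic basis. -/
def vf (i : l) : l ⊕ l → R := Pi.single (Sum.inr i) 1

theorem om_ve (i : l) (v : l ⊕ l → R) : om (ve i) v = v (Sum.inr i) := by
  simp [om_eq_sum, ve, Pi.single_apply]

theorem om_vf (i : l) (v : l ⊕ l → R) : om (vf i) v = -v (Sum.inl i) := by
  simp [om_eq_sum, vf, Pi.single_apply]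

theorem om_ve_ve (i j : l) : om (ve i) (ve j : l ⊕ l → R) = 0 := by
  rw [om_ve]; simp [ve]

theorem om_vf_vf (i j : l) : om (vf i) (vf j : l ⊕ l → R) = 0 := by
  rw [om_vf]; simp [vf]

theorem om_ve_vf (i : l) : om (ve i) (vf i : l ⊕ l → R) = 1 := by
  simp [om_ve, vf]

theorem om_vf_ve (i : l) : om (vf i) (ve i : l ⊕ l → R) = -1 := by
  simp [om_vf, ve]

theorem om_ve_vf_ne {i j : l} (h : i ≠ j) : om (ve i) (vf j : l ⊕ l → R) = 0 := by
  simp [om_ve, vf, h]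

theorem om_vf_ve_ne {i j : l} (h : i ≠ j) : om (vf i) (ve j : l ⊕ l → R) = 0 := by
  simp [om_vf, ve, h]

/-- The element of order four of the `i`-th copy of `SL₂`, with `e i ↦ -f i` and `f i ↦ e i`. -/
def weyl (i : l) : symplecticGroup l R := transv (ve i) * transv (vf i) * transv (ve i)

theorem weyl_mulVec (i : l) (v : l ⊕ l → R) : (weyl i).1 *ᵥ v =
    v + (om (ve i) v + om (vf i) v) • ve i + (om (vf i) v - om (ve i) v) • vf i := by
  simp only [weyl, mulVec_mul_apply, transv_mulVec, om_add_right, om_smul_right, om_ve_ve,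
    om_ve_vf, om_vf_ve]
  module

theorem weyl_mulVec_ve (i : l) : (weyl i).1 *ᵥ ve i = -(vf i : l ⊕ l → R) := by
  rw [weyl_mulVec, om_ve_ve, om_vf_ve]; module

theorem weyl_mulVec_vf (i : l) : (weyl i).1 *ᵥ vf i = (ve i : l ⊕ l → R) := by
  rw [weyl_mulVec, om_ve_vf, om_vf_vf]; module

theorem weyl_commute {i j : l} (h : i ≠ j) :
    Commute (weyl i : symplecticGroup l R) (weyl j) := by
  have h1 : Commute (transv (ve i : l ⊕ l → R)) (transv (ve j)) := transv_commute (om_ve_ve i j)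
  have h2 : Commute (transv (ve i : l ⊕ l → R)) (transv (vf j)) :=
    transv_commute (om_ve_vf_ne h)
  have h3 : Commute (transv (vf i : l ⊕ l → R)) (transv (ve j)) :=
    transv_commute (om_vf_ve_ne h)
  have h4 : Commute (transv (vf i : l ⊕ l → R)) (transv (vf j)) :=
    transv_commute (om_vf_vf i j)
  have h5 : Commute (transv (ve i : l ⊕ l → R)) (weyl j) := (h1.mul_right h2).mul_right h1
  have h6 : Commute (transv (vf i : l ⊕ l → R)) (weyl j) := (h3.mul_right h4).mul_right h3
  exact (h5.mul_left h6).mul_left h5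

theorem weyl_pow_four (i : l) : (weyl i : symplecticGroup l R) ^ 4 = 1 := by
  refine ext_mulVec fun v => ?_
  simp only [pow_succ, pow_zero, one_mul, mulVec_mul_apply]
  simp only [weyl_mulVec, om_add_right, om_smul_right, om_ve_ve, om_vf_vf, om_ve_vf, om_vf_ve]
  simp
  module

end Transvection

section BaseChange

variable {l R F : Type*} [DecidableEq l] [CommRing R] [Field F] (π : R →+* F)

theorem comp_ve (i : l) : π ∘ (ve i) = ve i := by
  ext j
  simp [ve, Pi.single_apply, apply_ite π]

theorem comp_vf (i : l) : π ∘ (vf i) = vf i := by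
  ext j
  simp [vf, Pi.single_apply, apply_ite π]

end BaseChange

section Action

variable {l R F : Type*} [DecidableEq l] [Fintype l] [CommRing R] [Field F] (π : R →+* F)

/-- The action of `Sp(R)` on `F`-vectors through a ring homomorphism `R → F`. -/
def act (u : symplecticGroup l R) : (l ⊕ l → F) →ₗ[F] (l ⊕ l → F) := (u.1.map π).mulVecLin

theorem act_one (v : l ⊕ l → F) : act π (1 : symplecticGroup l R) v = v := by
  simp [act]

theorem act_mul (u u' : symplecticGroup l R) (v : l ⊕ l → F) :
    act π (u * u') v = act π u (act π u' v) := by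
  simp [act, Matrix.map_mul, mulVec_mulVec]

theorem act_inv_act (u : symplecticGroup l R) (v : l ⊕ l → F) : act π u⁻¹ (act π u v) = v := by
  rw [← act_mul, inv_mul_cancel, act_one]

theorem act_inv_eq {u : symplecticGroup l R} {v w : l ⊕ l → F} (h : act π u w = v) :
    act π u⁻¹ v = w := by
  rw [← h, act_inv_act]

theorem act_comp (u : symplecticGroup l R) (v : l ⊕ l → R) :
    act π u (π ∘ v) = π ∘ (u.1 *ᵥ v) := by
  ext i
  simp [act, RingHom.map_mulVec]

theorem act_transv (v : l ⊕ l → R) (w : l ⊕ l → F) :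
    act π (transv v) w = w + om (π ∘ v) w • (π ∘ v) := by
  have : (transv v).1.map π = (transv (π ∘ v)).1 := by
    ext i j
    have : π ((v ᵥ* paperJ l R) j) = ((π ∘ v) ᵥ* paperJ l F) j := by
      rw [RingHom.map_vecMul]
      congr 2
      simp [paperJ, Matrix.fromBlocks_map, Matrix.map_neg]
    simp [transv, vecMulVec_apply, this, Matrix.one_apply, apply_ite π]
  rw [act, this, mulVecLin_apply, transv_mulVec]

theorem act_transv_inv (v : l ⊕ l → R) (w : l ⊕ l → F) :
    act π (transv v)⁻¹ w = w - om (π ∘ v) w • (π ∘ v) := by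
  refine act_inv_eq π ?_
  rw [act_transv, om_sub_right, om_smul_right, om_self]
  module

theorem act_weyl_inv (i : l) (v : l ⊕ l → F) : act π (weyl i)⁻¹ v =
    v + (om (vf i) v - om (ve i) v) • ve i - (om (ve i) v + om (vf i) v) • vf i := by
  refine act_inv_eq π ?_
  simp only [weyl, act_mul, act_transv, comp_ve, comp_vf, om_add_right, om_sub_right,
    om_smul_right, om_ve_ve, om_vf_vf, om_ve_vf, om_vf_ve]
  module

theorem act_weyl_inv_ve (i : l) : act π (weyl i)⁻¹ (ve i) = vf i := by
  rw [act_weyl_inv, om_ve_ve, om_vf_ve]; module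

theorem act_weyl_inv_vf (i : l) : act π (weyl i)⁻¹ (vf i) = -ve i := by
  rw [act_weyl_inv, om_ve_vf, om_vf_vf]; module

/-- A cocycle on `Sp(R)` with values in symmetric bilinear forms on `F^{2g}`. -/
structure FormCocycle where
  /-- The underlying function. -/
  toFun : symplecticGroup l R → (l ⊕ l → F) →ₗ[F] (l ⊕ l → F) →ₗ[F] F
  symm : ∀ u v w, toFun u v w = toFun u w v
  map_mul : ∀ u u' v w, toFun (u * u') v w =
    toFun u v w + toFun u' (act π u⁻¹ v) (act π u⁻¹ w)

namespace FormCocycle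

variable {π} (c : FormCocycle (l := l) π)

theorem map_one : c.toFun 1 = 0 := by
  refine LinearMap.ext₂ fun v w => ?_
  have := c.map_mul 1 1 v w
  simpa [act_one] using this

theorem commute_eq {u u' : symplecticGroup l R} (h : Commute u u') (v w : l ⊕ l → F) :
    c.toFun u v w + c.toFun u' (act π u⁻¹ v) (act π u⁻¹ w) =
      c.toFun u' v w + c.toFun u (act π u'⁻¹ v) (act π u'⁻¹ w) := by
  rw [← c.map_mul, ← c.map_mul, h.eq]

theorem conj_eq {u u' k : symplecticGroup l R} (hk : c.toFun k = 0) (h : k * u = u' * k)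
    (v w : l ⊕ l → F) : c.toFun u' v w = c.toFun u (act π k⁻¹ v) (act π k⁻¹ w) := by
  have h1 := c.map_mul k u v w
  have h2 := c.map_mul u' k v w
  rw [h, h2] at h1
  simpa [hk] using h1

/-- The subgroup on which a cocycle vanishes. -/
def ker : Subgroup (symplecticGroup l R) where
  carrier := {u | c.toFun u = 0}
  one_mem' := c.map_one
  mul_mem' := by
    intro u u' (h : c.toFun u = 0) (h' : c.toFun u' = 0)
    change c.toFun (u * u') = 0
    refine LinearMap.ext₂ fun v w => ?_
    simp [c.map_mul, h, h']
  inv_mem' := by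
    intro u (h : c.toFun u = 0)
    change c.toFun u⁻¹ = 0
    refine LinearMap.ext₂ fun v w => ?_
    have := c.map_mul u u⁻¹ (act π u v) (act π u w)
    simpa [c.map_one, h, act_inv_act] using this.symm

theorem mem_ker {u : symplecticGroup l R} : u ∈ c.ker ↔ c.toFun u = 0 := Iff.rfl

/-- The difference of a cocycle and the coboundary of a symmetric form. -/
def subCoboundary (β : (l ⊕ l → F) →ₗ[F] (l ⊕ l → F) →ₗ[F] F) (hβ : ∀ v w, β v w = β w v) :
    FormCocycle (l := l) π where
  toFun u := c.toFun u - (β.compl₁₂ (act π u⁻¹) (act π u⁻¹) - β)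
  symm u v w := by simp [c.symm u v w, hβ v w, hβ (act π u⁻¹ v) (act π u⁻¹ w)]
  map_mul u u' v w := by
    simp [c.map_mul, act_mul]
    ring

theorem subCoboundary_apply (β : (l ⊕ l → F) →ₗ[F] (l ⊕ l → F) →ₗ[F] F)
    (hβ : ∀ v w, β v w = β w v) (u : symplecticGroup l R) (v w : l ⊕ l → F) :
    (c.subCoboundary β hβ).toFun u v w =
      c.toFun u v w - (β (act π u⁻¹ v) (act π u⁻¹ w) - β v w) := rfl

end FormCocycle

theorem form_ext {Q : (l ⊕ l → F) →ₗ[F] (l ⊕ l → F) →ₗ[F] F}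
    (he : ∀ i w, Q (ve i) w = 0) (hf : ∀ i w, Q (vf i) w = 0) : Q = 0 := by
  refine (Pi.basisFun F (l ⊕ l)).ext fun a => ?_
  refine LinearMap.ext fun w => ?_
  rcases a with i | i
  · simpa [ve] using he i w
  · simpa [vf] using hf i w

theorem functional_ext {Q : (l ⊕ l → F) →ₗ[F] F}
    (he : ∀ i, Q (ve i) = 0) (hf : ∀ i, Q (vf i) = 0) (v : l ⊕ l → F) : Q v = 0 := by
  have : Q = 0 := by
    refine (Pi.basisFun F (l ⊕ l)).ext fun a => ?_
    rcases a with i | i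
    · simpa [ve] using he i
    · simpa [vf] using hf i
  rw [this, LinearMap.zero_apply]

/-- A symmetric form invariant under the transvection along `x` has `x` in its radical. -/
theorem radical_of_invariant (h2 : (2 : F) ≠ 0) {Q : (l ⊕ l → F) →ₗ[F] (l ⊕ l → F) →ₗ[F] F}
    (hQ : ∀ v w, Q v w = Q w v) {x y : l ⊕ l → F} (hxy : om x y ≠ 0)
    (hinv : ∀ v w, Q (v - om x v • x) (w - om x w • x) = Q v w) (w : l ⊕ l → F) :
    Q x w = 0 := by
  have h1 := hinv y y
  have h3 := hinv y x
  have h4 := hinv y w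
  simp only [map_sub, map_smul, LinearMap.sub_apply, LinearMap.smul_apply, smul_eq_mul,
    om_self, zero_mul, sub_zero] at h1 h3 h4
  rw [hQ y x] at h1 h3
  have hxx : Q x x = 0 := by
    have : om x y * Q x x = 0 := by linear_combination -h3
    exact (mul_eq_zero.1 this).resolve_left hxy
  have hxy0 : Q x y = 0 := by
    have : (2 * om x y) * Q x y = 0 := by linear_combination -h1 + om x y ^ 2 * hxx
    exact (mul_eq_zero.1 this).resolve_left (mul_ne_zero h2 hxy)
  have : om x y * Q x w = 0 := by
    rw [hQ y x] at h4
    linear_combination -h4 - om x w * hxy0 + om x w * om x y * hxx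
  exact (mul_eq_zero.1 this).resolve_left hxy

end Action

section Vanishing

variable {l R F : Type*} [DecidableEq l] [Fintype l] [CommRing R] [Field F] {π : R →+* F}
  (c : FormCocycle (l := l) π)

namespace FormCocycle

theorem radical_of_commute_transv (h2 : (2 : F) ≠ 0) {u : symplecticGroup l R}
    {x : l ⊕ l → R} {y : l ⊕ l → F} (hx : transv x ∈ c.ker) (hxy : om (π ∘ x) y ≠ 0)
    (hu : Commute u (transv x)) (w : l ⊕ l → F) : c.toFun u (π ∘ x) w = 0 := by
  refine radical_of_invariant h2 (c.symm u) hxy (fun v w => ?_) w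
  have := c.commute_eq hu v w
  rw [c.mem_ker.1 hx] at this
  simpa [act_transv_inv] using this.symm

theorem commute_transv_weyl {x : l ⊕ l → R} {j : l} (he : om x (ve j) = 0)
    (hf : om x (vf j) = 0) : Commute (transv x) (weyl j) :=
  ((transv_commute he).mul_right (transv_commute hf)).mul_right (transv_commute he)

theorem act_weyl_inv_of_orthogonal {j : l} {v : l ⊕ l → F} (he : om (ve j) v = 0)
    (hf : om (vf j) v = 0) : act π (weyl j)⁻¹ v = v := by
  simp [act_weyl_inv, he, hf]

/-- The form attached to `transv (ve i)` is supported on the `i`-th hyperbolic plane. -/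
theorem transv_ve_radical (h2 : (2 : F) ≠ 0) (hw : ∀ i, c.toFun (weyl i) = 0) {i j : l}
    (hij : i ≠ j) (v : l ⊕ l → F) :
    c.toFun (transv (ve i)) (ve j) v = 0 ∧ c.toFun (transv (ve i)) (vf j) v = 0 := by
  set Q := c.toFun (transv (ve i)) with hQ
  have hinv : ∀ v w, Q (act π (weyl j)⁻¹ v) (act π (weyl j)⁻¹ w) = Q v w := fun v w => by
    have := c.commute_eq (commute_transv_weyl (om_ve_ve i j) (om_ve_vf_ne hij)) v w
    rw [hw] at this
    simpa using this.symm
  have neg_zero_of : ∀ a : F, -a = a → a = 0 := fun a ha => by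
    have : 2 * a = 0 := by linear_combination -ha
    exact (mul_eq_zero.1 this).resolve_left h2
  have horth : ∀ w, om (ve j) w = 0 → om (vf j) w = 0 → Q (ve j) w = 0 ∧ Q (vf j) w = 0 := by
    intro w he hf
    have h1 := hinv (ve j) w
    have h3 := hinv (vf j) w
    rw [act_weyl_inv_of_orthogonal he hf, act_weyl_inv_ve] at h1
    rw [act_weyl_inv_of_orthogonal he hf, act_weyl_inv_vf, map_neg, LinearMap.neg_apply] at h3
    have : Q (ve j) w = 0 := neg_zero_of _ (h3.trans h1)
    exact ⟨this, h1.trans this⟩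
  have hef : Q (ve j) (vf j) = 0 := by
    have h1 := hinv (ve j) (vf j)
    rw [act_weyl_inv_ve, act_weyl_inv_vf, map_neg, c.symm] at h1
    exact neg_zero_of _ h1
  have hff : Q (vf j) (vf j) = Q (ve j) (ve j) := by
    have h1 := hinv (ve j) (ve j)
    rwa [act_weyl_inv_ve] at h1
  have hfe : Q (vf j) (ve j) = 0 := (c.symm _ _ _).trans hef
  have hee : Q (ve j) (ve j) = 0 := by
    have h := c.commute_eq (transv_commute (om_ve_ve i j)) (vf j) (vf j)
    simp only [act_transv_inv, comp_ve, om_ve_vf_ne hij, om_ve_vf, zero_smul, sub_zero, one_smul,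
      map_sub, LinearMap.sub_apply, ← hQ, hff, hef] at h
    linear_combination -h + hfe
  constructor
  · refine functional_ext (fun k => ?_) (fun k => ?_) v
    · by_cases hk : j = k
      · rw [← hk, hee]
      · exact (horth _ (om_ve_ve j k) (om_vf_ve_ne hk)).1
    · by_cases hk : j = k
      · rw [← hk, hef]
      · exact (horth _ (om_ve_vf_ne hk) (om_vf_vf j k)).1
  · refine functional_ext (fun k => ?_) (fun k => ?_) v
    · by_cases hk : j = k
      · rw [← hk, hfe]
      · exact (horth _ (om_ve_ve j k) (om_vf_ve_ne hk)).2
    · by_cases hk : j = k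
      · rw [← hk, hff, hee]
      · exact (horth _ (om_ve_vf_ne hk) (om_vf_vf j k)).2

theorem transv_ve_mem_ker [Nontrivial l] (h2 : (2 : F) ≠ 0) (hw : ∀ i, c.toFun (weyl i) = 0)
    (hef : ∀ i, c.toFun (transv (ve i)) (ve i) (vf i) = 0) (i : l) :
    transv (ve i) ∈ c.ker := by
  obtain ⟨j, hji⟩ := exists_ne i
  have hrad := fun (k : l) (hk : i ≠ k) => c.transv_ve_radical h2 hw hk
  set Q := c.toFun (transv (ve i)) with hQ
  have hee : Q (ve i) (ve i) = 0 := by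
    have hcomm : Commute (transv (ve i : l ⊕ l → R)) (transv (ve i + vf j)) :=
      transv_commute (by rw [om_add_right, om_ve_ve, om_ve_vf_ne hji.symm, add_zero])
    have h := c.commute_eq hcomm (ve j) (ve j)
    have hr : π ∘ (ve i + vf j : l ⊕ l → R) = ve i + vf j := by
      rw [← comp_ve π i, ← comp_vf π j]; ext; simp
    simp only [act_transv_inv, comp_ve, om_ve_ve, zero_smul, sub_zero, hr, om_add_left, om_vf_ve,
      zero_add, neg_smul, one_smul, sub_neg_eq_add, ← hQ, map_add, LinearMap.add_apply,
      (hrad j hji.symm _).1, (hrad j hji.symm _).2] at h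
    rw [c.symm _ (ve i) (ve j), c.symm _ (ve i) (vf j), (hrad j hji.symm _).1,
      (hrad j hji.symm _).2] at h
    linear_combination -h
  have hff : Q (vf i) (vf i) = 0 := by
    have hconj : weyl i * transv (ve i : l ⊕ l → R) = transv (vf i) * weyl i := by
      rw [mul_transv, weyl_mulVec_ve, transv_neg]
    have h := c.map_mul (transv (ve i) * transv (vf i)) (transv (ve i)) (vf i) (vf i)
    rw [← weyl, hw, c.map_mul, c.conj_eq (hw i) hconj] at h
    have h3 : act π (transv (ve i : l ⊕ l → R))⁻¹ (vf i) = vf i - ve i := by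
      rw [act_transv_inv, comp_ve, om_ve_vf, one_smul]
    have h4 : act π (transv (ve i : l ⊕ l → R) * transv (vf i))⁻¹ (vf i) = -ve i := by
      rw [_root_.mul_inv_rev, act_mul, h3, act_transv_inv, comp_vf, om_sub_right, om_vf_vf,
        om_vf_ve]
      module
    have hfe : Q (vf i) (ve i) = 0 := (c.symm _ _ _).trans (hef i)
    simp only [h3, h4, act_weyl_inv_ve, act_weyl_inv_vf, map_sub, map_neg, LinearMap.sub_apply,
      LinearMap.neg_apply, LinearMap.zero_apply, ← hQ, hee, hfe] at h
    have : 2 * Q (vf i) (vf i) = 0 := by linear_combination -h - hef i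
    exact (mul_eq_zero.1 this).resolve_left h2
  have key : ∀ k, (∀ w, Q (ve k) w = 0) ∧ ∀ w, Q (vf k) w = 0 := by
    intro k
    by_cases hk : i = k
    · subst hk
      constructor <;> refine functional_ext (fun k => ?_) (fun k => ?_)
      all_goals
        by_cases hk : i = k
        · subst hk
          first | assumption | exact hef i | exact (c.symm _ _ _).trans (hef i)
        · rw [c.symm]
          first | exact (hrad k hk _).1 | exact (hrad k hk _).2
    · exact ⟨fun w => (hrad k hk w).1, fun w => (hrad k hk w).2⟩
  exact form_ext (fun k => (key k).1) fun k => (key k).2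

theorem short_radical (h2 : (2 : F) ≠ 0) (he : ∀ i, transv (ve i) ∈ c.ker)
    (hf : ∀ i, transv (vf i) ∈ c.ker) {i j : l} :
    (∀ k, k ≠ j → ∀ w, c.toFun (transv (ve i + vf j)) (ve k) w = 0) ∧
      ∀ k, k ≠ i → ∀ w, c.toFun (transv (ve i + vf j)) (vf k) w = 0 := by
  constructor
  · intro k hk w
    have h : Commute (transv (ve i + vf j : l ⊕ l → R)) (transv (ve k)) := by
      refine transv_commute ?_
      rw [om_add_left, om_ve_ve, om_vf_ve_ne hk.symm, add_zero]
    have := c.radical_of_commute_transv h2 (y := vf k) (he k) (by simp [comp_ve, om_ve_vf]) h w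
    rwa [comp_ve] at this
  · intro k hk w
    have h : Commute (transv (ve i + vf j : l ⊕ l → R)) (transv (vf k)) := by
      refine transv_commute ?_
      rw [om_add_left, om_ve_vf_ne hk.symm, om_vf_vf, add_zero]
    have := c.radical_of_commute_transv h2 (y := ve k) (hf k) (by simp [comp_vf, om_vf_ve]) h w
    rwa [comp_vf] at this

theorem transv_add_mul_transv_sub {x y : l ⊕ l → R} (h : om x y = 0) :
    transv (x + y) * transv (x - y) = transv x ^ 2 * transv y ^ 2 := by
  refine ext_mulVec fun w => ?_
  have h' : om y x = 0 := by rw [om_swap, h, neg_zero]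
  rw [sub_eq_add_neg]
  simp only [mulVec_mul_apply, transv_pow_mulVec, transv_mulVec, om_add_left, om_add_right,
    om_smul_right, om_self, h, h', om_neg_left, om_neg_right]
  push_cast
  module

theorem short_mem_ker (h2 : (2 : F) ≠ 0) (hw : ∀ i, weyl i ∈ c.ker)
    (he : ∀ i, transv (ve i) ∈ c.ker) (hf : ∀ i, transv (vf i) ∈ c.ker) {i j : l} (hij : i ≠ j) :
    transv (ve i + vf j) ∈ c.ker := by
  obtain ⟨hre, hrf⟩ := c.short_radical h2 he hf (i := i) (j := j)
  have comp_short : ∀ i j : l, π ∘ (ve i + vf j : l ⊕ l → R) = ve i + vf j := fun i j => by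
    rw [← comp_ve π i, ← comp_vf π j]; ext; simp
  set Q := c.toFun (transv (ve i + vf j)) with hQ
  have zero_of_two : ∀ a : F, 2 * a = 0 → a = 0 := fun a ha =>
    (mul_eq_zero.1 ha).resolve_left h2
  -- `weyl j ^ 2` carries the root vector `ve i + vf j` to `ve i - vf j`
  have hkk : c.toFun (weyl j * weyl j) = 0 := c.ker.mul_mem (hw j) (hw j)
  have hconj : (weyl j * weyl j) * transv (ve i + vf j : l ⊕ l → R) =
      transv (ve i - vf j) * (weyl j * weyl j) := by
    rw [mul_transv, mulVec_mul_apply, mulVec_add, mulVec_add, weyl_mulVec_vf, weyl_mulVec_ve,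
      weyl_mulVec j (ve i), om_ve_ve, om_vf_ve_ne hij.symm]
    simp [sub_eq_add_neg, weyl_mulVec j (ve i), om_ve_ve, om_vf_ve_ne hij.symm]
  have hsum : ∀ v, Q v v + c.toFun (transv (ve i - vf j)) (act π (transv (ve i + vf j))⁻¹ v)
      (act π (transv (ve i + vf j))⁻¹ v) = 0 := fun v => by
    have h : c.toFun (transv (ve i + vf j) * transv (ve i - vf j)) = 0 := by
      rw [transv_add_mul_transv_sub (om_ve_vf_ne hij)]
      exact c.ker.mul_mem (c.ker.pow_mem (he i) 2) (c.ker.pow_mem (hf j) 2)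
    rw [hQ, ← c.map_mul, h]
    simp
  have hff : Q (vf i) (vf i) = 0 := by
    have h := hsum (vf i)
    rw [c.conj_eq hkk hconj] at h
    simp only [_root_.mul_inv_rev, act_mul, act_transv_inv, comp_short, om_add_left, om_ve_vf,
      om_vf_vf, add_zero, one_smul, map_sub, map_add, act_weyl_inv_vf, map_neg, act_weyl_inv_ve,
      act_weyl_inv_of_orthogonal (π := π) (om_ve_ve j i) (om_vf_ve_ne hij.symm),
      act_weyl_inv_of_orthogonal (π := π) (om_ve_vf_ne hij.symm) (om_vf_vf j i),
      LinearMap.sub_apply, LinearMap.add_apply, LinearMap.neg_apply, ← hQ, hre i hij,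
      hrf j hij.symm] at h
    rw [c.symm _ (vf i) (ve i), c.symm _ (vf i) (vf j), hre i hij, hrf j hij.symm] at h
    exact zero_of_two _ (by linear_combination h)
  have hee : Q (ve j) (ve j) = 0 := by
    have h := hsum (ve j)
    rw [c.conj_eq hkk hconj] at h
    simp only [_root_.mul_inv_rev, act_mul, act_transv_inv, comp_short, om_add_left, om_ve_ve,
      om_vf_ve, zero_add, neg_smul, one_smul, map_sub, map_add, act_weyl_inv_vf, map_neg,
      act_weyl_inv_ve,
      act_weyl_inv_of_orthogonal (π := π) (om_ve_ve j i) (om_vf_ve_ne hij.symm),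
      LinearMap.sub_apply, LinearMap.add_apply, LinearMap.neg_apply, ← hQ, hre i hij,
      hrf j hij.symm] at h
    rw [c.symm _ (ve j) (ve i), c.symm _ (ve j) (vf j), hre i hij, hrf j hij.symm] at h
    exact zero_of_two _ (by linear_combination h)
  have hef : Q (ve j) (vf i) = 0 := by
    have hcomm : Commute (transv (ve i + vf j : l ⊕ l → R)) (transv (ve j + vf i)) := by
      refine transv_commute ?_
      simp only [om_add_left, om_add_right, om_ve_ve, om_vf_vf, om_ve_vf, om_vf_ve]
      ring
    have h := c.commute_eq hcomm (vf j) (vf j)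
    simp only [act_transv_inv, comp_short, om_add_left, om_ve_vf, om_vf_vf, om_ve_vf_ne hij,
      add_zero, zero_smul, one_smul, sub_zero, map_sub, map_add, LinearMap.sub_apply,
      LinearMap.add_apply, ← hQ, hrf j hij.symm, hee, hff] at h
    rw [c.symm _ (vf i) (ve j), c.symm _ (ve j) (vf j), c.symm _ (vf i) (vf j), ← hQ,
      hrf j hij.symm, hrf j hij.symm] at h
    exact zero_of_two _ (by linear_combination -h)
  refine form_ext (fun k => ?_) (fun k => ?_)
  · by_cases hk : k = j
    · subst hk
      refine functional_ext (fun m => ?_) (fun m => ?_)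
      · by_cases hm : m = k
        · rw [hm, ← hQ, hee]
        · rw [c.symm, hre m hm]
      · by_cases hm : m = i
        · rw [hm, ← hQ, hef]
        · rw [c.symm, hrf m hm]
    · exact hre k hk
  · by_cases hk : k = i
    · subst hk
      refine functional_ext (fun m => ?_) (fun m => ?_)
      · by_cases hm : m = j
        · rw [hm, c.symm, ← hQ, hef]
        · rw [c.symm, hre m hm]
      · by_cases hm : m = k
        · rw [hm, ← hQ, hff]
        · rw [c.symm, hrf m hm]
    · exact hrf k hk

end FormCocycle

end Vanishing

section Transitivity

variable {l R : Type*} [DecidableEq l] [Fintype l] [CommRing R] {K : Subgroup (symplecticGroup l R)}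

theorem transv_mulVec_mem_iff {k : symplecticGroup l R} (hk : k ∈ K) (v : l ⊕ l → R) :
    transv (k.1 *ᵥ v) ∈ K ↔ transv v ∈ K := by
  have h : transv (k.1 *ᵥ v) = k * transv v * k⁻¹ := by
    rw [mul_transv, mul_inv_cancel_right]
  rw [h, K.mul_mem_cancel_right (K.inv_mem hk), K.mul_mem_cancel_left hk]

theorem transv_mem_of_shift (hR : ∀ r : R, ∃ n : ℕ, (n : R) = r) {x y : l ⊕ l → R}
    (hxy : om x y = 0) (hx : transv x ∈ K) (hy : transv y ∈ K) (hadd : transv (x + y) ∈ K)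
    (r : R) {v : l ⊕ l → R} (h : transv (v + r • (om x v • y + om y v • x)) ∈ K) :
    transv v ∈ K := by
  obtain ⟨n, rfl⟩ := hR r
  have hyx : om y x = 0 := by rw [om_swap, hxy, neg_zero]
  set k := (transv x ^ n)⁻¹ * ((transv y ^ n)⁻¹ * transv (x + y) ^ n) with hk
  have hkK : k ∈ K := K.mul_mem (K.inv_mem (K.pow_mem hx n))
    (K.mul_mem (K.inv_mem (K.pow_mem hy n)) (K.pow_mem hadd n))
  rw [← transv_mulVec_mem_iff hkK]
  convert h using 2
  rw [hk, mulVec_mul_apply, mulVec_mul_apply]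
  refine inv_mulVec_eq ?_
  symm
  refine inv_mulVec_eq ?_
  simp only [transv_pow_mulVec, om_add_left, om_add_right, om_smul_right, om_self, hxy, hyx]
  module

theorem transv_mem_of_isUnit_ve (hR : ∀ r : R, ∃ n : ℕ, (n : R) = r)
    (he : ∀ i, transv (ve i) ∈ K) (hf : ∀ i, transv (vf i) ∈ K)
    (hs : ∀ i j, i ≠ j → transv (ve i + vf j) ∈ K) (i : l) (s : Finset l) :
    ∀ v : l ⊕ l → R, IsUnit (v (Sum.inl i)) →
      (∀ j, j ∉ s → j ≠ i → v (Sum.inl j) = 0 ∧ v (Sum.inr j) = 0) → transv v ∈ K := by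
  have hw : ∀ i, weyl i ∈ K := fun i => K.mul_mem (K.mul_mem (he i) (hf i)) (he i)
  induction s using Finset.induction_on with
  | empty =>
    intro v hv h0
    obtain ⟨r, hr⟩ := hv
    obtain ⟨n, hn⟩ := hR (↑r⁻¹ * v (Sum.inr i))
    obtain ⟨m, hm⟩ := hR (r * r)
    rw [← transv_mulVec_mem_iff (K.pow_mem (hf i) n)]
    have hv' : (transv (vf i) ^ n).1 *ᵥ v = (r : R) • ve i := by
      rw [transv_pow_mulVec, hn, om_vf, ← hr]
      ext (j | j)
      · by_cases hj : j = i
        · subst hj; simp [ve, vf, hr]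
        · simp [ve, vf, hj, h0 j (Finset.notMem_empty j) hj]
      · by_cases hj : j = i
        · subst hj
          simp only [Pi.add_apply, Pi.smul_apply, vf, ve, Pi.single_eq_same, smul_eq_mul]
          have : (↑r⁻¹ : R) * r = 1 := r.inv_mul
          simp
          linear_combination (-v (Sum.inr j)) * this
        · simp [ve, vf, hj, h0 j (Finset.notMem_empty j) hj]
    have hpow : transv ((r : R) • ve i : l ⊕ l → R) = transv (ve i) ^ m := by
      refine ext_mulVec fun w => ?_
      rw [transv_mulVec, transv_pow_mulVec, hm, om_smul_left]
      module
    rw [hv', hpow]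
    exact K.pow_mem (he i) m
  | insert j s hjs ih =>
    intro v hv h0
    by_cases hji : j = i
    · exact ih v hv fun k hk hki => h0 k (by simp [hk, hji, hki]) hki
    obtain ⟨r, hr⟩ := hv
    have hinv : (↑r⁻¹ : R) * r = 1 := r.inv_mul
    have hvf : transv (vf i + -vf j : l ⊕ l → R) ∈ K := by
      have := (transv_mulVec_mem_iff (hw j) (ve j + vf i)).2 (hs j i hji)
      rw [mulVec_add, weyl_mulVec_ve, weyl_mulVec, om_ve_vf_ne hji, om_vf_vf] at this
      simpa [add_comm] using this
    refine transv_mem_of_shift hR (x := vf i) (y := ve j) (om_vf_ve_ne (Ne.symm hji)) (hf i) (he j)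
      (by rw [add_comm]; exact hs j i hji) (↑r⁻¹ * v (Sum.inl j)) ?_
    refine transv_mem_of_shift hR (x := vf i) (y := -vf j)
      (by rw [om_neg_right, om_vf_vf, neg_zero]) (hf i)
      (by rw [transv_neg]; exact hf j) hvf (-(↑r⁻¹ * v (Sum.inr j))) ?_
    refine ih _ ?_ ?_
    · have := r.isUnit
      rw [hr] at this
      simpa [ve, vf, Ne.symm hji] using this
    · intro k hk hki
      by_cases hkj : k = j
      · subst hkj
        simp only [om_add_right, om_smul_right, om_vf, om_ve, om_neg_left, ← hr]
        constructor
        · simp [ve, vf, hki]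
          linear_combination (-v (Sum.inl k)) * hinv
        · simp [ve, vf, hki]
          linear_combination (-v (Sum.inr k)) * hinv
      · have := h0 k (by simp [hk, hkj]) hki
        simp [ve, vf, hki, hkj, this]

theorem transv_mem_of_isUnit (hR : ∀ r : R, ∃ n : ℕ, (n : R) = r)
    (he : ∀ i, transv (ve i) ∈ K) (hf : ∀ i, transv (vf i) ∈ K)
    (hs : ∀ i j, i ≠ j → transv (ve i + vf j) ∈ K) {v : l ⊕ l → R} {a : l ⊕ l}
    (ha : IsUnit (v a)) : transv v ∈ K := by
  have key : ∀ (i : l) (v : l ⊕ l → R), IsUnit (v (Sum.inl i)) → transv v ∈ K := fun i v hv =>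
    transv_mem_of_isUnit_ve hR he hf hs i Finset.univ v hv fun j hj =>
      absurd (Finset.mem_univ j) hj
  rcases a with i | i
  · exact key i v ha
  · have hw : weyl i ∈ K := K.mul_mem (K.mul_mem (he i) (hf i)) (he i)
    rw [← transv_mulVec_mem_iff hw]
    refine key i _ ?_
    rw [weyl_mulVec, om_ve, om_vf]
    simpa [ve, vf] using ha

end Transitivity

section Coboundary

variable {l R F : Type*} [DecidableEq l] [Fintype l] [CommRing R] [Field F] {π : R →+* F}

namespace FormCocycle

/-- A cocycle vanishing on the Weyl elements, and normalised on the transvections along the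
`ve i`, is zero. -/
theorem toFun_eq_zero [Nontrivial l] (c : FormCocycle (l := l) π) (h2 : (2 : F) ≠ 0)
    (hR : ∀ r : R, ∃ n : ℕ, (n : R) = r) (hloc : ∀ r : R, π r ≠ 0 → IsUnit r)
    (hw : ∀ i, c.toFun (weyl i) = 0) (hef : ∀ i, c.toFun (transv (ve i)) (ve i) (vf i) = 0)
    (u : symplecticGroup l R) : c.toFun u = 0 := by
  have he := c.transv_ve_mem_ker h2 hw hef
  have hf : ∀ i, transv (vf i) ∈ c.ker := fun i => by
    have := (transv_mulVec_mem_iff (K := c.ker) (hw i) (ve i)).2 (he i)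
    rwa [weyl_mulVec_ve, transv_neg] at this
  have hT : ∀ x : l ⊕ l → R, π ∘ x ≠ 0 → transv x ∈ c.ker := fun x hx => by
    obtain ⟨a, ha⟩ := Function.ne_iff.1 hx
    exact transv_mem_of_isUnit hR he hf (fun i j hij => c.short_mem_ker h2 hw he hf hij)
      (hloc _ ha)
  have hrad : ∀ (x : l ⊕ l → R) (y : l ⊕ l → F), om (π ∘ x) y ≠ 0 →
      ∀ w, c.toFun u (π ∘ x) w = 0 := by
    intro x y hxy
    have hx : π ∘ x ≠ 0 := by
      intro h
      simp [h, om] at hxy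
    have hx' : π ∘ ((u⁻¹).1 *ᵥ x) ≠ 0 := by
      rw [← act_comp]
      intro h
      apply hx
      rw [← act_inv_act π u⁻¹ (π ∘ x), h, map_zero]
    have hcomm : u * transv ((u⁻¹).1 *ᵥ x) = transv x * u := by
      rw [mul_transv, ← mulVec_mul_apply, mul_inv_cancel]
      simp
    refine radical_of_invariant h2 (c.symm u) hxy fun v w => ?_
    have h := c.map_mul u (transv ((u⁻¹).1 *ᵥ x)) v w
    rw [hcomm, c.map_mul, c.mem_ker.1 (hT x hx), c.mem_ker.1 (hT _ hx')] at h
    simpa [act_transv_inv] using h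
  refine form_ext (fun i => ?_) (fun i => ?_)
  · have := hrad (ve i) (vf i)
    rw [comp_ve] at this
    exact this (by simp [om_ve_vf])
  · have := hrad (vf i) (ve i)
    rw [comp_vf] at this
    exact this (by simp [om_vf_ve])

theorem closure_weyl_isPGroup :
    IsPGroup 2 (Subgroup.closure (Set.range (weyl : l → symplecticGroup l R))) := by
  have hcomm : ∀ x ∈ Set.range (weyl : l → symplecticGroup l R),
      ∀ y ∈ Set.range (weyl : l → symplecticGroup l R), x * y = y * x := by
    rintro _ ⟨i, rfl⟩ _ ⟨j, rfl⟩
    by_cases h : i = j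
    · rw [h]
    · exact (weyl_commute h).eq
  have hc := Subgroup.isMulCommutative_closure hcomm
  rintro ⟨x, hx⟩
  refine ⟨2, ?_⟩
  apply Subtype.ext
  change x ^ 4 = 1
  induction hx using Subgroup.closure_induction with
  | mem x hx => obtain ⟨i, rfl⟩ := hx; exact weyl_pow_four i
  | one => exact one_pow 4
  | mul x y hx hy hx4 hy4 =>
    have hxy : Commute x y := congrArg Subtype.val (hc.is_comm.comm ⟨x, hx⟩ ⟨y, hy⟩)
    rw [hxy.mul_pow, hx4, hy4, one_mul]
  | inv x _ hx4 => rw [inv_pow, hx4, inv_one]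

theorem exists_coboundary_of_finite (c : FormCocycle (l := l) π)
    (W : Subgroup (symplecticGroup l R)) [Finite W] (hW : (Nat.card W : F) ≠ 0) :
    ∃ β : (l ⊕ l → F) →ₗ[F] (l ⊕ l → F) →ₗ[F] F, (∀ v w, β v w = β w v) ∧
      ∀ u ∈ W, ∀ v w, c.toFun u v w = β (act π u⁻¹ v) (act π u⁻¹ w) - β v w := by
  have := Fintype.ofFinite W
  rw [Nat.card_eq_fintype_card] at hW
  have happ : ∀ v w, (∑ h : W, c.toFun h) v w = ∑ h : W, c.toFun h v w := by simp
  refine ⟨-(Fintype.card W : F)⁻¹ • ∑ h : W, c.toFun h, fun v w => ?_, fun u hu v w => ?_⟩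
  · simp only [LinearMap.smul_apply, happ]
    simp_rw [c.symm _ v w]
  · have key : ∑ h : W, c.toFun h v w = Fintype.card W * c.toFun u v w +
        ∑ h : W, c.toFun h (act π u⁻¹ v) (act π u⁻¹ w) := by
      rw [← Equiv.sum_comp (Equiv.mulLeft (⟨u, hu⟩ : W)) fun h : W => c.toFun h v w]
      simp [c.map_mul, Finset.sum_add_distrib]
    simp only [LinearMap.smul_apply, happ, key, smul_eq_mul]
    field_simp
    ring

theorem exists_coboundary [Nontrivial l] [Finite R] (c : FormCocycle (l := l) π)
    (h2 : (2 : F) ≠ 0) (hR : ∀ r : R, ∃ n : ℕ, (n : R) = r)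
    (hloc : ∀ r : R, π r ≠ 0 → IsUnit r) :
    ∃ β : (l ⊕ l → F) →ₗ[F] (l ⊕ l → F) →ₗ[F] F, (∀ v w, β v w = β w v) ∧
      ∀ u v w, c.toFun u v w = β (act π u⁻¹ v) (act π u⁻¹ w) - β v w := by
  set W := Subgroup.closure (Set.range (weyl : l → symplecticGroup l R)) with hWdef
  have : Finite W := inferInstance
  have hW : (Nat.card W : F) ≠ 0 := by
    obtain ⟨n, hn⟩ := (IsPGroup.iff_card (p := 2)).1 (closure_weyl_isPGroup (l := l) (R := R))
    rw [← hWdef] at hn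
    rw [hn]
    push_cast
    exact pow_ne_zero n h2
  obtain ⟨β₀, hβ₀, hW₀⟩ := c.exists_coboundary_of_finite W hW
  set c₁ := c.subCoboundary β₀ hβ₀ with hc₁
  have hw₁ : ∀ i, c₁.toFun (weyl i) = 0 := fun i => by
    refine LinearMap.ext₂ fun v w => ?_
    rw [hc₁, subCoboundary_apply, hW₀ _ (Subgroup.subset_closure ⟨i, rfl⟩), sub_self]
    rfl
  set a : l → F := fun i => -c₁.toFun (transv (ve i)) (ve i) (vf i) with ha
  set β₁ : (l ⊕ l → F) →ₗ[F] (l ⊕ l → F) →ₗ[F] F := LinearMap.mk₂ F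
    (fun v w => ∑ i, a i * (om (ve i) v * om (ve i) w + om (vf i) v * om (vf i) w))
    (fun v v' w => by
      rw [← Finset.sum_add_distrib]
      exact Finset.sum_congr rfl fun i _ => by simp only [om_add_right]; ring)
    (fun r v w => by
      rw [smul_eq_mul, Finset.mul_sum]
      exact Finset.sum_congr rfl fun i _ => by simp only [om_smul_right]; ring)
    (fun v w w' => by
      rw [← Finset.sum_add_distrib]
      exact Finset.sum_congr rfl fun i _ => by simp only [om_add_right]; ring)
    (fun r v w => by
      rw [smul_eq_mul, Finset.mul_sum]
      exact Finset.sum_congr rfl fun i _ => by simp only [om_smul_right]; ring) with hβ₁def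
  have hβ₁app : ∀ v w, β₁ v w =
      ∑ i, a i * (om (ve i) v * om (ve i) w + om (vf i) v * om (vf i) w) := fun v w => rfl
  have hβ₁ : ∀ v w, β₁ v w = β₁ w v := fun v w => by
    rw [hβ₁app, hβ₁app]
    exact Finset.sum_congr rfl fun i _ => by ring
  have hinv : ∀ j v w, β₁ (act π (weyl j)⁻¹ v) (act π (weyl j)⁻¹ w) = β₁ v w := fun j v w => by
    rw [hβ₁app, hβ₁app]
    refine Finset.sum_congr rfl fun i _ => ?_
    by_cases hij : i = j
    · subst hij
      simp only [act_weyl_inv, om_add_right, om_sub_right, om_smul_right, om_ve_ve, om_ve_vf,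
        om_vf_ve, om_vf_vf]
      ring
    · simp only [act_weyl_inv, om_add_right, om_sub_right, om_smul_right, om_ve_ve,
        om_ve_vf_ne hij, om_vf_ve_ne hij, om_vf_vf]
      ring
  have hdiag : ∀ i, β₁ (ve i) (ve i) = a i := fun i => by
    rw [hβ₁app, Finset.sum_eq_single i]
    · simp [om_ve_ve, om_vf_ve]
    · intro k _ hk
      simp [om_ve_ve, om_vf_ve_ne hk]
    · simp
  have hzero := (c₁.subCoboundary β₁ hβ₁).toFun_eq_zero h2 hR hloc
    (fun i => by
      refine LinearMap.ext₂ fun v w => ?_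
      rw [subCoboundary_apply, hinv, hw₁]
      simp)
    (fun i => by
      rw [subCoboundary_apply, act_transv_inv, act_transv_inv, comp_ve, om_ve_ve, om_ve_vf]
      simp [hdiag, ha])
  refine ⟨β₀ + β₁, fun v w => ?_, fun u v w => ?_⟩
  · simp [hβ₀ v w, hβ₁ v w]
  · have h := congrArg (fun Q => Q v w) (hzero u)
    simp only [subCoboundary_apply, hc₁, LinearMap.zero_apply] at h
    simp only [LinearMap.add_apply]
    linear_combination h

end FormCocycle

end Coboundary

section Dual

variable {l F : Type*} [DecidableEq l] [Fintype l] [Field F]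

theorem paperJ_mul_self : paperJ l F * paperJ l F = -1 := by
  rw [paperJ, Matrix.fromBlocks_multiply]
  simp [← Matrix.fromBlocks_one, Matrix.fromBlocks_neg]

/-- The symmetric bilinear map `(v, w) ↦ (v·ᵀw + w·ᵀv)·J` into `sp`. -/
def symSp : (l ⊕ l → F) →ₗ[F] (l ⊕ l → F) →ₗ[F] spLie l F :=
  LinearMap.mk₂ F
    (fun v w => ⟨(vecMulVec v w + vecMulVec w v) * paperJ l F, by
      change ((vecMulVec v w + vecMulVec w v) * paperJ l F)ᵀ * paperJ l F +
        paperJ l F * ((vecMulVec v w + vecMulVec w v) * paperJ l F) = 0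
      rw [transpose_mul, transpose_add, transpose_vecMulVec, transpose_vecMulVec,
        paperJ_transpose, add_comm (vecMulVec w v), Matrix.mul_assoc]
      simp⟩)
    (fun v v' w => Subtype.ext (by
      simp [vecMulVec_add, add_vecMulVec, Matrix.add_mul]; abel))
    (fun r v w => Subtype.ext (by simp [smul_vecMulVec, vecMulVec_smul, Matrix.add_mul]))
    (fun v w w' => Subtype.ext (by
      simp [vecMulVec_add, add_vecMulVec, Matrix.add_mul]; abel))
    (fun r v w => Subtype.ext (by simp [smul_vecMulVec, vecMulVec_smul, Matrix.add_mul]))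

theorem coe_symSp (v w : l ⊕ l → F) :
    (symSp v w : Matrix (l ⊕ l) (l ⊕ l) F) = (vecMulVec v w + vecMulVec w v) * paperJ l F := rfl

theorem symSp_comm (v w : l ⊕ l → F) : symSp v w = symSp w v :=
  Subtype.ext (by rw [coe_symSp, coe_symSp, add_comm])

theorem mul_paperJ_transpose (X : spLie l F) :
    ((X : Matrix (l ⊕ l) (l ⊕ l) F) * paperJ l F)ᵀ = X * paperJ l F := by
  have hX : (X : Matrix (l ⊕ l) (l ⊕ l) F)ᵀ * paperJ l F + paperJ l F * X = 0 := X.2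
  have h : paperJ l F * ((X : Matrix (l ⊕ l) (l ⊕ l) F)ᵀ * paperJ l F + paperJ l F * X) *
      paperJ l F = 0 := by rw [hX]; simp
  rw [Matrix.mul_add, Matrix.add_mul, ← Matrix.mul_assoc, ← Matrix.mul_assoc,
    Matrix.mul_assoc _ (paperJ l F) (paperJ l F), paperJ_mul_self] at h
  rw [transpose_mul, paperJ_transpose, Matrix.neg_mul]
  simp only [Matrix.mul_neg, Matrix.mul_one, Matrix.neg_mul, Matrix.one_mul] at h
  exact sub_eq_zero.1 (by rw [← h]; abel)

/-- The expansion of an element of `sp` in the elements `symSp`. -/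
theorem eq_sum_symSp (h2 : (2 : F) ≠ 0) (X : spLie l F) :
    X = (-2⁻¹ : F) • ∑ a, ∑ b, ((X : Matrix (l ⊕ l) (l ⊕ l) F) * paperJ l F) a b •
      symSp (Pi.single a 1) (Pi.single b 1) := by
  apply Subtype.ext
  have hS : ∀ S : Matrix (l ⊕ l) (l ⊕ l) F,
      ∑ a, ∑ b, S a b • vecMulVec (Pi.single a 1) (Pi.single b 1) = S := fun S => by
    conv_rhs => rw [matrix_eq_sum_single S]
    refine Finset.sum_congr rfl fun a _ => Finset.sum_congr rfl fun b _ => ?_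
    rw [← single_eq_single_vecMulVec_single, smul_single, smul_eq_mul, mul_one]
  set S := (X : Matrix (l ⊕ l) (l ⊕ l) F) * paperJ l F with hSdef
  have hST : ∑ a, ∑ b, S a b • vecMulVec (Pi.single b (1 : F)) (Pi.single a 1) = S := by
    rw [Finset.sum_comm]
    conv_rhs => rw [← hS S]
    refine Finset.sum_congr rfl fun a _ => Finset.sum_congr rfl fun b _ => ?_
    rw [show S b a = S a b from congrFun (congrFun (mul_paperJ_transpose X) a) b]
  have hsum : ∑ a, ∑ b, S a b • ((vecMulVec (Pi.single a 1) (Pi.single b 1) +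
      vecMulVec (Pi.single b 1) (Pi.single a 1)) * paperJ l F) = (S + S) * paperJ l F := by
    simp only [← Matrix.smul_mul, ← Matrix.sum_mul, smul_add, Finset.sum_add_distrib, hS, hST]
  simp only [Submodule.coe_smul, Submodule.coe_sum, coe_symSp, hsum]
  rw [hSdef, Matrix.add_mul, Matrix.mul_assoc, paperJ_mul_self, ← two_smul F, smul_smul]
  simp [h2]

/-- The functional on `sp` attached to a bilinear form. -/
def dualOfForm (β : (l ⊕ l → F) →ₗ[F] (l ⊕ l → F) →ₗ[F] F) : spLie l F →ₗ[F] F where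
  toFun X := (-2⁻¹ : F) * ∑ a, ∑ b, ((X : Matrix (l ⊕ l) (l ⊕ l) F) * paperJ l F) a b *
    β (Pi.single a 1) (Pi.single b 1)
  map_add' X Y := by
    simp only [Submodule.coe_add, Matrix.add_apply, add_mul, Finset.sum_add_distrib, mul_add]
  map_smul' r X := by
    simp only [Submodule.coe_smul, Matrix.smul_mul, Matrix.smul_apply, smul_eq_mul,
      Finset.mul_sum, RingHom.id_apply]
    exact Finset.sum_congr rfl fun a _ => Finset.sum_congr rfl fun b _ => by ring

theorem form_eq_sum (β : (l ⊕ l → F) →ₗ[F] (l ⊕ l → F) →ₗ[F] F) (v w : l ⊕ l → F) :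
    β v w = ∑ a, ∑ b, v a * w b * β (Pi.single a 1) (Pi.single b 1) := by
  rw [LinearMap.pi_apply_eq_sum_univ β v, LinearMap.sum_apply]
  refine Finset.sum_congr rfl fun a _ => ?_
  rw [LinearMap.smul_apply, LinearMap.pi_apply_eq_sum_univ (β _) w,
    Finset.smul_sum]
  refine Finset.sum_congr rfl fun b _ => ?_
  have h : ∀ i : l ⊕ l, (fun j => if i = j then (1 : F) else 0) = Pi.single i 1 := fun i => by
    ext j
    simp [Pi.single_apply, eq_comm]
  rw [h, h, smul_eq_mul, smul_eq_mul, mul_assoc]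

theorem dualOfForm_symSp (h2 : (2 : F) ≠ 0) {β : (l ⊕ l → F) →ₗ[F] (l ⊕ l → F) →ₗ[F] F}
    (hβ : ∀ v w, β v w = β w v) (v w : l ⊕ l → F) : dualOfForm β (symSp v w) = β v w := by
  have hJ : (symSp v w : Matrix (l ⊕ l) (l ⊕ l) F) * paperJ l F =
      -(vecMulVec v w + vecMulVec w v) := by
    rw [coe_symSp, Matrix.mul_assoc, paperJ_mul_self, Matrix.mul_neg, Matrix.mul_one]
  have h : ∑ a, ∑ b, ((symSp v w : Matrix (l ⊕ l) (l ⊕ l) F) * paperJ l F) a b *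
      β (Pi.single a 1) (Pi.single b 1) = -(β v w + β w v) := by
    rw [hJ, form_eq_sum β v w, form_eq_sum β w v]
    simp only [Matrix.neg_apply, Matrix.add_apply, vecMulVec_apply, neg_mul, add_mul,
      Finset.sum_neg_distrib, Finset.sum_add_distrib]
  change (-2⁻¹ : F) * _ = _
  rw [h, hβ w v]
  field_simp
  ring

theorem conj_symSp {U U' : Matrix (l ⊕ l) (l ⊕ l) F} (hU : U' * U = 1)
    (hU' : U' ∈ symplecticGroup l F) (v w : l ⊕ l → F) :
    U' * (symSp v w : Matrix (l ⊕ l) (l ⊕ l) F) * U = symSp (U' *ᵥ v) (U' *ᵥ w) := by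
  have h := (mem_symplecticGroup_iff_paper U').1 hU'
  have hJ : paperJ l F * U = U'ᵀ * paperJ l F := by
    calc paperJ l F * U = U'ᵀ * paperJ l F * U' * U := by rw [h]
      _ = U'ᵀ * paperJ l F := by rw [Matrix.mul_assoc _ U' U, hU, Matrix.mul_one]
  rw [coe_symSp, coe_symSp, Matrix.mul_assoc, Matrix.mul_assoc, hJ, ← Matrix.mul_assoc,
    ← Matrix.mul_assoc]
  congr 1
  rw [Matrix.mul_add, Matrix.add_mul, mul_vecMulVec, mul_vecMulVec, vecMulVec_mul, vecMulVec_mul,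
    vecMul_transpose, vecMul_transpose]

end Dual

end SpCohomology

/-- Let `g ≥ 3`, `p` an odd prime and `s ≥ 1`.  Let `M` be the `ℤ/pℤ`-linear
dual of `sp_{2g}(ℤ/pℤ)`, on which `G = Sp_{2g}(ℤ/p^sℤ)` acts by `(u·φ)(X) = φ(ū⁻¹·X·ū)`
via reduction `u ↦ ū` modulo `p`.  Then `H¹(G, M) = 0`.  Concretely: every `1`-cocycle
`c : G → M` (satisfying `c(uv) = c(u) + u·c(v)`) is a coboundary `c(u) = u·φ − φ`. -/
theorem h1_coadjoint_dual_vanishes (g p s : ℕ) (hg : 3 ≤ g) (hp : p.Prime) (hpodd : Odd p)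
    (hs : 1 ≤ s)
    (c : ↥(Matrix.symplecticGroup (Fin g) (ZMod (p ^ s))) →
      (↥(spLie (Fin g) (ZMod p)) →ₗ[ZMod p] ZMod p))
    (hcoc : ∀ u v : ↥(Matrix.symplecticGroup (Fin g) (ZMod (p ^ s))), ∀ X Y : ↥(spLie (Fin g) (ZMod p)),
      (Y : Matrix (Fin g ⊕ Fin g) (Fin g ⊕ Fin g) (ZMod p)) =
          (matRed g p s hs (u : Matrix _ _ (ZMod (p ^ s))))⁻¹ * (X : Matrix _ _ (ZMod p)) * matRed g p s hs (u : Matrix _ _ (ZMod (p ^ s))) →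
        c (u * v) X = c u X + c v Y) :
    ∃ φ : ↥(spLie (Fin g) (ZMod p)) →ₗ[ZMod p] ZMod p,
      ∀ u : ↥(Matrix.symplecticGroup (Fin g) (ZMod (p ^ s))), ∀ X Y : ↥(spLie (Fin g) (ZMod p)),
        (Y : Matrix (Fin g ⊕ Fin g) (Fin g ⊕ Fin g) (ZMod p)) =
            (matRed g p s hs (u : Matrix _ _ (ZMod (p ^ s))))⁻¹ * (X : Matrix _ _ (ZMod p)) * matRed g p s hs (u : Matrix _ _ (ZMod (p ^ s))) →
          c u X = φ Y - φ X := by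
  have : Fact p.Prime := ⟨hp⟩
  have : NeZero (p ^ s) := ⟨pow_ne_zero s hp.ne_zero⟩
  have : Nontrivial (Fin g) := Fin.nontrivial_iff_two_le.2 (by omega)
  have h2 : (2 : ZMod p) ≠ 0 := by
    have h : ((2 : ℕ) : ZMod p) ≠ 0 := by
      rw [Ne, ZMod.natCast_eq_zero_iff, Nat.prime_dvd_prime_iff_eq hp Nat.prime_two]
      rintro rfl
      exact absurd hpodd (by decide)
    exact_mod_cast h
  set π : ZMod (p ^ s) →+* ZMod p :=
    ZMod.castHom (dvd_pow_self p (Nat.one_le_iff_ne_zero.mp hs)) (ZMod p) with hπ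
  have hR : ∀ r : ZMod (p ^ s), ∃ n : ℕ, (n : ZMod (p ^ s)) = r := fun r =>
    ⟨r.val, ZMod.natCast_zmod_val r⟩
  have hloc : ∀ r : ZMod (p ^ s), π r ≠ 0 → IsUnit r := by
    intro r hr
    obtain ⟨n, rfl⟩ := hR r
    rw [map_natCast, Ne, ZMod.natCast_eq_zero_iff] at hr
    rw [ZMod.isUnit_iff_coprime]
    exact (((Nat.Prime.coprime_iff_not_dvd hp).2 hr).pow_left s).symm
  have hmul : ∀ u : symplecticGroup (Fin g) (ZMod (p ^ s)),
      (u⁻¹).1.map π * u.1.map π = 1 := fun u => by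
    rw [← Matrix.map_mul, ← Submonoid.coe_mul, inv_mul_cancel]
    simp
  have hinv : ∀ u : symplecticGroup (Fin g) (ZMod (p ^ s)),
      (matRed g p s hs u.1)⁻¹ = (u⁻¹).1.map π := fun u => Matrix.inv_eq_left_inv (hmul u)
  have hmem : ∀ u : symplecticGroup (Fin g) (ZMod (p ^ s)),
      u.1.map π ∈ symplecticGroup (Fin g) (ZMod p) := fun u => by
    have hJ : (paperJ (Fin g) (ZMod (p ^ s))).map π = paperJ (Fin g) (ZMod p) := by
      simp [paperJ, Matrix.fromBlocks_map, Matrix.map_neg]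
    have h := congrArg (fun M => M.map π) ((mem_symplecticGroup_iff_paper u.1).1 u.2)
    simp only [Matrix.map_mul, hJ] at h
    exact (mem_symplecticGroup_iff_paper _).2 h
  have hconj : ∀ (u : symplecticGroup (Fin g) (ZMod (p ^ s))) (v w : Fin g ⊕ Fin g → ZMod p),
      (SpCohomology.symSp (SpCohomology.act π u⁻¹ v) (SpCohomology.act π u⁻¹ w) :
        Matrix (Fin g ⊕ Fin g) (Fin g ⊕ Fin g) (ZMod p)) =
      (matRed g p s hs u.1)⁻¹ * (SpCohomology.symSp v w : Matrix _ _ (ZMod p)) *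
        matRed g p s hs u.1 := fun u v w => by
    rw [hinv]
    exact (SpCohomology.conj_symSp (hmul u) (hmem u⁻¹) v w).symm
  let C : SpCohomology.FormCocycle (l := Fin g) π :=
    { toFun := fun u => SpCohomology.symSp.compr₂ (c u)
      symm := fun u v w => by
        simp only [LinearMap.compr₂_apply, SpCohomology.symSp_comm v w]
      map_mul := fun u u' v w => hcoc u u' _ _ (hconj u v w) }
  obtain ⟨β, hβ, hC⟩ := C.exists_coboundary h2 hR hloc
  refine ⟨SpCohomology.dualOfForm β, fun u X Y hXY => ?_⟩
  have hX := SpCohomology.eq_sum_symSp h2 X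
  set S := (X : Matrix (Fin g ⊕ Fin g) (Fin g ⊕ Fin g) (ZMod p)) * paperJ (Fin g) (ZMod p)
  have hY : Y = (-2⁻¹ : ZMod p) • ∑ a, ∑ b, S a b •
      SpCohomology.symSp (SpCohomology.act π u⁻¹ (Pi.single a 1))
        (SpCohomology.act π u⁻¹ (Pi.single b 1)) := by
    apply Subtype.ext
    rw [hXY, congrArg Subtype.val hX]
    simp only [Submodule.coe_smul, Submodule.coe_sum, hconj, Matrix.mul_smul, Matrix.smul_mul,
      Matrix.mul_sum, Matrix.sum_mul]
  have hCu : ∀ v w, c u (SpCohomology.symSp v w) =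
      β (SpCohomology.act π u⁻¹ v) (SpCohomology.act π u⁻¹ w) - β v w := hC u
  rw [hY, hX]
  simp only [map_smul, map_sum, hCu, SpCohomology.dualOfForm_symSp h2 hβ, smul_eq_mul, mul_sub,
    Finset.sum_sub_distrib]
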